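/- Suppose k, n, m are positive integers with k ≥ 150, n > m ≥ 1, a1, a2 ∈ {1,…,9}, and P_k = a1·(10^n−1)/9 − a2·(10^m−1)/9. Then k < 1.25·10^{29}. -/

import Mathlib

/-- The Pell sequence: `P 0 = 0`, `P 1 = 1`, `P (n+2) = 2 * P (n+1) + P n`. -/
def pell : ℕ → ℕ
  | 0 => 0
  | 1 => 1
  | n + 2 => 2 * pell (n + 1) + pell n

/-! ### Part 1: congruence sieve -/

/-- Residues of the Pell numbers modulo `Q = 400 * 7 * 11 * 31 * 41 * 241`. -/
def pellTbl : List ℕ :=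
  [0, 1, 2, 5, 12, 29, 70, 169,
   408, 985, 2378, 5741, 13860, 33461, 80782, 195025,
   470832, 1136689, 2744210, 6625109, 15994428, 38613965, 93222358, 225058681,
   543339720, 1311738121, 3166815962, 7645370045, 9023177252, 6822966949, 3800353550, 4989295249,
   4344565248, 4244046945, 3398280338, 1606228821, 6610737980, 5393325981, 7963011142, 2450590665,
   3429813672, 9310218009, 3181492090, 6238823389, 6224760068, 9253964725, 5863931918, 2113070961,
   655695040, 3424461041, 7504617122, 8999316485, 6634492492, 3399543869, 3999201430, 1963567929,
   7926337288, 8381863705, 5821307098, 1155720301, 8132747700, 7986836901, 5237663902, 9027785905,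
   4424478112, 8442363329, 2440447170, 3888878869, 783826108, 5456531085, 2262509478, 547171241,
   3356851960, 7260875161, 8444223482, 5280564525, 136594932, 5553754389, 1809724910, 9173204209,
   1287375728, 2313576865, 5914529458, 4708256981, 5896664620, 7067207421, 1162321862, 9391851145,
   1077266552, 2112005449, 5301277450, 3280181549, 2427261748, 8134705045, 9262293038, 7790533521,
   5974602480, 870980881, 7716564242, 6869730565, 2587267772, 2609887309, 7807042390, 8789593289,
   6517471368, 2955778425, 2994649418, 8945077261, 2016046340, 3542791141, 9101628622, 2877290785,
   5421831392, 4286574769, 4560602130, 3973400229, 3073023788, 685069005, 4443161798, 137013801,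
   4717189400, 137013801, 4991217002, 685069005, 6361355012, 3973400229, 4873776670, 4286574769,
   4012547408, 2877290785, 332750178, 3542791141, 7418332460, 8945077261, 6439729382, 2955778425,
   2916907432, 8789593289, 1627336410, 2609887309, 6847111028, 6869730565, 1717814558, 870980881,
   3459776320, 7790533521, 172085762, 8134705045, 7007117052, 3280181549, 4133101350, 2112005449,
   8357112248, 9391851145, 8272056938, 7067207421, 3537714180, 4708256981, 3519849342, 2313576865,
   8147003072, 9173204209, 7624653890, 5553754389, 9297783868, 5280564525, 990155318, 7260875161,
   6077526840, 547171241, 7171869322, 5456531085, 8650552692, 3888878869, 6993931630, 8442363329,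
   5009900688, 9027785905, 4196714898, 7986836901, 1301631100, 1155720301, 3613071702, 8381863705,
   1508041512, 1963567929, 5435177370, 3399543869, 2799886308, 8999316485, 1929761678, 3424461041,
   8778683760, 2113070961, 3570446882, 9253964725, 3209618732, 6238823389, 6252886710, 9310218009,
   6004565128, 2450590665, 1471367658, 5393325981, 2823640820, 1606228821, 6036098462, 4244046945,
   5089813552, 4989295249, 5634025250, 6822966949, 411201548, 7645370045, 6267562838, 1311738121,
   8891039080, 225058681, 9341156442, 38613965, 9418384372, 6625109, 9431634590, 1136689,
   9433907968, 195025, 9434298018, 33461, 9434364940, 5741, 9434376422, 985,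
   9434378392, 169, 9434378730, 29, 9434378788, 5, 9434378798, 1]

def tenTbl : List ℕ :=
  [1, 10, 100, 1000, 10000, 100000, 1000000, 10000000, 5656212, 9390226,
   23144419, 19170667, 3019094, 6604993, 18878036, 92784, 927840, 9278400, 22026159, 7988067,
   9122829, 20470449, 16016914, 18653458, 21432951, 2055987, 20559870, 16911124, 4009611, 16510163]

lemma pellTbl_rec : ∀ i < 240,
    pellTbl.getD ((i + 2) % 240) 0
      = (2 * pellTbl.getD ((i + 1) % 240) 0 + pellTbl.getD i 0) % 9434378800 := by
  decide +kernel

lemma pell_mod_tbl (k : ℕ) :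
    pell k % 9434378800 = pellTbl.getD (k % 240) 0 ∧
    pell (k + 1) % 9434378800 = pellTbl.getD ((k + 1) % 240) 0 := by
  induction k with
  | zero => decide +kernel
  | succ k ih =>
    refine ⟨ih.2, ?_⟩
    have h := pellTbl_rec (k % 240) (Nat.mod_lt _ (by norm_num))
    have e1 : (k % 240 + 2) % 240 = (k + 1 + 1) % 240 := by omega
    have e2 : (k % 240 + 1) % 240 = (k + 1) % 240 := by omega
    rw [e1, e2, ← ih.1, ← ih.2] at h
    rw [h]
    show (2 * pell (k + 1) + pell k) % _ = _
    omega

lemma tenTbl_spec (n : ℕ) : 10 ^ n % 23585947 = tenTbl.getD (n % 30) 0 := by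
  have h : ∀ i < 30, 10 ^ i % 23585947 = tenTbl.getD i 0 := by decide +kernel
  rw [← h (n % 30) (Nat.mod_lt _ (by norm_num))]
  conv_lhs => rw [← Nat.div_add_mod n 30, pow_add, pow_mul, Nat.mul_mod, Nat.pow_mod]
  have : (10 : ℕ) ^ 30 % 23585947 = 1 := by norm_num
  rw [this]
  simp

/-- sieve for `m ≥ 4`, `a1 ≠ a2` -/
def sieveA : Bool :=
  (List.range 240).all fun k => (List.range 10).all fun a1 => (List.range 10).all fun a2 =>
    (a1 == 0) || (a2 == 0) || (a1 == a2) ||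
    !((9 * pellTbl.getD k 0 + a1) % 400 == a2) ||
    (tenTbl.all fun u => tenTbl.all fun w =>
      !((9 * pellTbl.getD k 0 + a1 + a2 * w) % 23585947 == (a1 * u + a2) % 23585947))

/-- sieve for `m ≥ 4`, `a1 = a2` -/
def sieveB : Bool :=
  (List.range 240).all fun k => (List.range 10).all fun a1 => 
    (a1 == 0) || (k % 60 == 0) ||
    !((9 * pellTbl.getD k 0 + a1) % 400 == a1)

/-- sieve for `1 ≤ m ≤ 3` -/
def sieveC : Bool :=
  (List.range 240).all fun k => (List.range 10).all fun a1 => (List.range 10).all fun a2 =>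
    [10, 100, 1000].all fun w =>
    (a1 == 0) || (a2 == 0) || ((a1 == a2) && (k % 60 == 0)) ||
    !((9 * pellTbl.getD k 0 + a1 + a2 * w) % 400 == a2) ||
    (tenTbl.all fun u =>
      !((9 * pellTbl.getD k 0 + a1 + a2 * w) % 23585947 == (a1 * u + a2) % 23585947))

lemma sieveA_true : sieveA = true := by decide +kernel
lemma sieveB_true : sieveB = true := by decide +kernel
lemma sieveC_true : sieveC = true := by decide +kernel

lemma tenTbl_mem (n : ℕ) : 10 ^ n % 23585947 ∈ tenTbl := by
  rw [tenTbl_spec]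
  have h : n % 30 < tenTbl.length := Nat.mod_lt _ (by norm_num)
  rw [List.getD_eq_getElem _ _ h]
  exact List.getElem_mem _

lemma sieve (k n m a1 a2 : ℕ) (hn : 5 ≤ n) (hm : 1 ≤ m)
    (ha11 : 1 ≤ a1) (ha19 : a1 ≤ 9) (ha21 : 1 ≤ a2) (ha29 : a2 ≤ 9)
    (heq : 9 * pell k + a1 + a2 * 10 ^ m = a1 * 10 ^ n + a2) : a1 = a2 ∧ 60 ∣ k := by
  have hk := (pell_mod_tbl k).1
  have hkl : k % 240 < 240 := Nat.mod_lt _ (by norm_num)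
  set j := k % 240 with hj
  set P := pellTbl.getD j 0 with hP
  have h10n : 10 ^ n = 400 * (25 * 10 ^ (n - 4)) := by
    obtain ⟨r, rfl⟩ := Nat.exists_eq_add_of_le hn
    rw [show 5 + r - 4 = r + 1 by omega]
    ring
  have key : (9 * P + a1 + a2 * (10 ^ m % 23585947)) % 23585947
      = (a1 * (10 ^ n % 23585947) + a2) % 23585947 := by
    have h1 : pell k % 23585947 = P % 23585947 := by omega
    have h2 : (9 * P + a1 + a2 * (10 ^ m % 23585947)) ≡ (9 * pell k + a1 + a2 * 10 ^ m)
        [MOD 23585947] := by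
      gcongr ?_ + _ + ?_
      · exact Nat.ModEq.mul_left _ h1.symm
      · exact Nat.ModEq.mul_left _ (Nat.mod_modEq _ _)
    have h3 : (a1 * (10 ^ n % 23585947) + a2) ≡ (a1 * 10 ^ n + a2) [MOD 23585947] := by
      gcongr ?_ + _
      exact Nat.ModEq.mul_left _ (Nat.mod_modEq _ _)
    rw [heq] at h2
    exact h2.trans h3.symm
  have hP400 : pell k % 400 = P % 400 := by omega
  by_cases hm4 : 4 ≤ m
  · have h10m : 10 ^ m = 400 * (25 * 10 ^ (m - 4)) := by
      obtain ⟨r, rfl⟩ := Nat.exists_eq_add_of_le hm4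
      rw [show 4 + r - 4 = r by omega]
      ring
    have h400 : (9 * P + a1) % 400 = a2 := by
      have : 9 * pell k + a1 + 400 * (a2 * (25 * 10 ^ (m - 4)))
          = 400 * (a1 * (25 * 10 ^ (n - 4))) + a2 := by
        rw [h10m, h10n] at heq
        linarith
      omega
    by_cases h12 : a1 = a2
    · refine ⟨h12, ?_⟩
      have h := sieveB_true
      simp only [sieveB, List.all_eq_true, List.mem_range] at h
      have h := h j hkl a1 (by omega)
      subst h12
      rw [← hP] at h
      simp [h400] at h
      omega
    · exfalso
      have h := sieveA_true
      simp only [sieveA, List.all_eq_true, List.mem_range] at h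
      have h := h j hkl a1 (by omega) a2 (by omega)
      rw [← hP] at h
      simp only [Bool.or_eq_true, beq_iff_eq, h400, List.all_eq_true] at h
      rcases h with ((((h | h) | h) | h) | h)
      · omega
      · omega
      · omega
      · simp at h
      · have h := h _ (tenTbl_mem n) _ (tenTbl_mem m)
        rw [key] at h
        simp at h
  · have hw : 10 ^ m ∈ [10, 100, 1000] := by
      have : m = 1 ∨ m = 2 ∨ m = 3 := by omega
      rcases this with rfl | rfl | rfl <;> simp
    have hwm : 10 ^ m % 23585947 = 10 ^ m := by
      have : m = 1 ∨ m = 2 ∨ m = 3 := by omega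
      rcases this with rfl | rfl | rfl <;> simp
    rw [hwm] at key
    have h400 : (9 * P + a1 + a2 * 10 ^ m) % 400 = a2 := by
      have : 9 * pell k + a1 + a2 * 10 ^ m
          = 400 * (a1 * (25 * 10 ^ (n - 4))) + a2 := by
        rw [h10n] at heq
        linarith
      omega
    have h := sieveC_true
    simp only [sieveC, List.all_eq_true, List.mem_range] at h
    have h := h j hkl a1 (by omega) a2 (by omega) _ hw
    rw [← hP] at h
    simp only [Bool.or_eq_true, Bool.and_eq_true, beq_iff_eq, h400, List.all_eq_true] at h
    rcases h with ((((h | h) | h) | h) | h)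
    · omega
    · omega
    · exact ⟨h.1, by omega⟩
    · simp at h
    · have h := h _ (tenTbl_mem n)
      rw [key] at h
      simp at h

section SiegelBound
attribute [local instance] Matrix.seminormedAddCommGroup

lemma siegel_aux {ι κ : Type} [Fintype ι] [Fintype κ]
    (hcard : Fintype.card κ = 2 * Fintype.card ι) (hpos : 0 < Fintype.card ι)
    (M : ι → κ → ℤ) (U : ℕ) (hU : 1 ≤ U) (hM : ∀ i j, |M i j| ≤ (U : ℤ)) :
    ∃ t : κ → ℤ, t ≠ 0 ∧ (∀ i, ∑ j, M i j * t j = 0) ∧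
      ∀ j, |t j| ≤ ((Fintype.card κ * U : ℕ) : ℤ) := by
  obtain ⟨t, ht, hA, hn⟩ := Int.Matrix.exists_ne_zero_int_vec_norm_le (Matrix.of M)
    (by omega) hpos
  refine ⟨t, ht, ?_, ?_⟩
  · intro i
    have := congrFun hA i
    simpa [Matrix.mulVec, dotProduct] using this
  · intro j
    have h1 : ((Fintype.card ι : ℝ) / ((Fintype.card κ : ℝ) - Fintype.card ι)) = 1 := by
      rw [hcard]; push_cast
      have : (Fintype.card ι : ℝ) ≠ 0 := by exact_mod_cast hpos.ne'
      rw [div_eq_one_iff_eq]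
      · ring
      · intro h; apply this; linarith
    rw [h1, Real.rpow_one] at hn
    have h2 : ‖Matrix.of M‖ ≤ (U : ℝ) := by
      rw [Matrix.norm_le_iff (by positivity)]
      intro i j
      simp only [Matrix.of_apply]
      rw [Int.norm_eq_abs]
      exact_mod_cast hM i j
    have h3 : max 1 ‖Matrix.of M‖ ≤ (U : ℝ) := max_le (by exact_mod_cast hU) h2
    have h4 : ‖t j‖ ≤ ‖t‖ := norm_le_pi_norm t j
    rw [Int.norm_eq_abs] at h4
    have h5 : (|(t j : ℝ)|) ≤ (Fintype.card κ : ℝ) * U := by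
      refine h4.trans (hn.trans ?_)
      gcongr
    exact_mod_cast h5

end SiegelBound

lemma not_square_two (n : ℤ) : (2 : ℤ) ≠ n * n := by
  intro h
  have h1 : n.natAbs * n.natAbs = 2 := by
    zify; rw [abs_mul_abs_self]; exact h.symm
  have h2 : n.natAbs < 2 := by nlinarith
  interval_cases n.natAbs <;> omega

instance instNZD2 : NoZeroDivisors (ℤ√2) where
  eq_zero_or_eq_zero_of_mul_eq_zero := by
    intro a b h
    have h1 : Zsqrtd.norm a * Zsqrtd.norm b = 0 := by
      rw [← Zsqrtd.norm_mul, h, Zsqrtd.norm_zero]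
    rcases mul_eq_zero.mp h1 with h2 | h2
    · left; exact (Zsqrtd.norm_eq_zero not_square_two a).mp h2
    · right; exact (Zsqrtd.norm_eq_zero not_square_two b).mp h2

instance instDom2 : IsDomain (ℤ√2) := NoZeroDivisors.to_isDomain _

lemma five_ne_zero_R : (5 : ℤ√2) ≠ 0 := by
  intro h
  have := congrArg Zsqrtd.re h
  simp at this

lemma cop_cancel (u : ℤ) (hu : ¬ (5 : ℤ) ∣ u) (N : ℕ) (z : ℤ√2)
    (h : (5 : ℤ√2) ^ N ∣ (u : ℤ√2) * z) : (5 : ℤ√2) ^ N ∣ z := by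
  have h1 : IsCoprime (5 : ℤ) u :=
    ((Prime.coprime_iff_not_dvd (by exact_mod_cast (Nat.prime_iff_prime_int.mp Nat.prime_five)))).mpr hu
  have h2 := (h1.map (Int.castRingHom (ℤ√2))).pow_left (m := N)
  simp only [eq_intCast, Int.cast_ofNat] at h2
  exact h2.dvd_of_dvd_mul_left h

lemma diff_cancel (L N : ℕ) (e : ℤ) (he : ¬ (5 : ℤ) ^ L ∣ e) (z : ℤ√2)
    (h : (5 : ℤ√2) ^ N ∣ (5 * (e : ℤ√2)) * z) : (5 : ℤ√2) ^ (N - L) ∣ z := by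
  have hne : e ≠ 0 := by rintro rfl; exact he (dvd_zero _)
  have hfin : FiniteMultiplicity (5 : ℤ) e := by
    rw [Int.finiteMultiplicity_iff]
    exact ⟨by decide, hne⟩
  obtain ⟨u, hu, hnd⟩ := hfin.exists_eq_pow_mul_and_not_dvd
  set j := multiplicity (5 : ℤ) e
  have hj : j < L := by
    by_contra hc
    push Not at hc
    exact he (hu ▸ (pow_dvd_pow 5 hc).mul_right u)
  rcases Nat.lt_or_ge N L with hlt | hge
  · rw [Nat.sub_eq_zero_of_le hlt.le]; simp
  · apply cop_cancel u hnd
    have h1 : (5 : ℤ√2) ^ (j + 1) * 5 ^ (N - (j + 1)) ∣ 5 ^ (j + 1) * (u * z) := by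
      rw [← pow_add, Nat.add_sub_cancel' (by omega)]
      have : (5 * (e : ℤ√2)) * z = 5 ^ (j + 1) * (u * z) := by
        conv_lhs => rw [hu]
        push_cast; ring
      rwa [← this]
    have h2 := (mul_dvd_mul_iff_left (pow_ne_zero _ five_ne_zero_R)).mp h1
    exact (pow_dvd_pow 5 (by omega)).trans h2

open Polynomial in
lemma lemB (L : ℕ) (hL : 1 ≤ L) (I : Finset ℤ) :
    ∀ (N : ℕ) (G : (ℤ√2)[X]), L * I.card ≤ N →
    (∀ s ∈ I, (5 : ℤ√2) ^ N ∣ G.eval (5 * (s : ℤ√2))) →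
    (∀ s ∈ I, ∀ t ∈ I, s ≠ t → ¬ (5 : ℤ) ^ L ∣ s - t) →
    ∀ t : ℤ, (5 : ℤ√2) ^ I.card ∣ G.eval (5 * (t : ℤ√2)) := by
  induction I using Finset.induction_on with
  | empty => intros; simp
  | insert s0 I hs0 ih =>
    intro N G hN hG hd t
    rw [Finset.card_insert_of_notMem hs0] at hN ⊢
    obtain ⟨Q, hQ⟩ := X_sub_C_dvd_sub_C_eval (p := G) (a := 5 * (s0 : ℤ√2))
    have hev : ∀ w : ℤ, G.eval (5 * (w : ℤ√2)) =
        G.eval (5 * (s0 : ℤ√2)) + 5 * ((w - s0 : ℤ) : ℤ√2) * Q.eval (5 * (w : ℤ√2)) := by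
      intro w
      have := congrArg (Polynomial.eval (5 * (w : ℤ√2))) hQ
      simp only [eval_sub, eval_C, eval_mul, eval_X] at this
      push_cast
      linear_combination this
    have hs0N := hG s0 (Finset.mem_insert_self _ _)
    have hQ2 := ih (N - L) Q (by rw [mul_add] at hN; omega) (by
        intro s hs
        have h1 := hG s (Finset.mem_insert_of_mem hs)
        rw [hev s] at h1
        have h2 := (dvd_add_right hs0N).mp h1
        exact diff_cancel L N _ (hd s (Finset.mem_insert_of_mem hs) s0
          (Finset.mem_insert_self _ _) (by rintro rfl; exact hs0 hs)) _ h2)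
        (fun s hs t ht => hd s (Finset.mem_insert_of_mem hs) t (Finset.mem_insert_of_mem ht)) t
    rw [hev t]
    apply dvd_add
    · exact (pow_dvd_pow 5 (by nlinarith)).trans hs0N
    · rw [pow_succ', mul_assoc]
      exact mul_dvd_mul_left 5 (hQ2.mul_left _)

open Polynomial in
lemma growth (p : ℕ → ℕ → ℤ) (T B x1 : ℕ) (P : ℝ) (th : ℝ) (hth : 2 ≤ th)
    (hP : ∀ a b, |(p a b : ℝ)| ≤ P)
    (hz : ∀ x < x1 + T, ∑ b ∈ Finset.range B,
      (∑ a ∈ Finset.range T, (p a b : ℝ) * (x : ℝ) ^ a) * th ^ (b * x) = 0)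
    (hx1 : 1 ≤ x1)
    (hgr : ∀ x, x1 ≤ x → x < x1 + T → (B : ℝ) * (T * P * (x : ℝ) ^ T) < 2 ^ x) :
    ∀ b < B, ∀ a < T, p a b = 0 := by
  by_contra hcon
  push Not at hcon
  have hex : ∃ b, b < B ∧ ∃ a < T, p a b ≠ 0 := by
    obtain ⟨b, hb, a, ha, h⟩ := hcon
    exact ⟨b, hb, a, ha, h⟩
  classical
  obtain ⟨b0, ⟨hb0, a0, ha0, hne⟩, hmax⟩ :
      ∃ b0, (b0 < B ∧ ∃ a < T, p a b0 ≠ 0) ∧ ∀ b, (b < B ∧ ∃ a < T, p a b ≠ 0) → b ≤ b0 := by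
    obtain ⟨b, hb⟩ := hex
    refine ⟨Nat.findGreatest (fun b => b < B ∧ ∃ a < T, p a b ≠ 0) B,
      Nat.findGreatest_spec (P := fun b => b < B ∧ ∃ a < T, p a b ≠ 0) hb.1.le hb, ?_⟩
    intro b hb
    exact Nat.le_findGreatest hb.1.le hb
  -- polynomial
  set Q : ℤ[X] := ∑ a ∈ Finset.range T, C (p a b0) * X ^ a with hQ
  have hQne : Q ≠ 0 := by
    intro h
    have := congrArg (fun q => coeff q a0) h
    simp [hQ, finset_sum_coeff, coeff_C_mul, coeff_X_pow] at this
    exact hne (this ha0)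
  have hdeg : Q.natDegree < T := by
    have : Q.degree < T := by
      rw [hQ, Polynomial.degree_lt_iff_coeff_zero]
      intro m hm
      simp [finset_sum_coeff, coeff_C_mul, coeff_X_pow]
      intro h; omega
    exact (Polynomial.natDegree_lt_iff_degree_lt hQne).mpr this
  obtain ⟨x, hx, hxe⟩ : ∃ x ∈ Finset.Ico x1 (x1 + T), Q.eval (x : ℤ) ≠ 0 := by
    by_contra hc
    push Not at hc
    apply hQne
    apply Polynomial.eq_zero_of_natDegree_lt_card_of_eval_eq_zero' Q
      ((Finset.Ico x1 (x1 + T)).image (fun n : ℕ => (n : ℤ)))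
    · intro i hi
      obtain ⟨n, hn, rfl⟩ := Finset.mem_image.mp hi
      exact hc n hn
    · rw [Finset.card_image_of_injective _ Nat.cast_injective]
      simpa using hdeg
  rw [Finset.mem_Ico] at hx
  have hev : Q.eval (x : ℤ) = ∑ a ∈ Finset.range T, p a b0 * (x : ℤ) ^ a := by
    simp [hQ, eval_finset_sum]
  have hone : (1 : ℝ) ≤ |∑ a ∈ Finset.range T, (p a b0 : ℝ) * (x : ℝ) ^ a| := by
    have := Int.one_le_abs hxe
    rw [hev] at this
    exact_mod_cast this
  have h0 := hz x hx.2
  have hP0 : 0 ≤ P := (abs_nonneg _).trans (hP 0 0)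
  have hx0 : (1 : ℝ) ≤ x := by exact_mod_cast (hx1.trans hx.1)
  have hth0 : 0 < th := by linarith
  have hsplit : ∑ b ∈ Finset.range B,
      (∑ a ∈ Finset.range T, (p a b : ℝ) * (x : ℝ) ^ a) * th ^ (b * x) =
      ∑ b ∈ Finset.range (b0 + 1),
      (∑ a ∈ Finset.range T, (p a b : ℝ) * (x : ℝ) ^ a) * th ^ (b * x) := by
    symm
    apply Finset.sum_subset
    · intro b; simp only [Finset.mem_range]; omega
    · intro b hb hb2
      simp only [Finset.mem_range] at hb hb2
      have : ∀ a ∈ Finset.range T, (p a b : ℝ) * (x : ℝ) ^ a = 0 := by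
        intro a ha
        by_contra hne2
        have hpn : p a b ≠ 0 := by
          rintro h; rw [h] at hne2; simp at hne2
        have := hmax b ⟨hb, a, Finset.mem_range.mp ha, hpn⟩
        omega
      rw [Finset.sum_eq_zero this, zero_mul]
  rw [hsplit, Finset.sum_range_succ] at h0
  have hbnd : ∀ b ∈ Finset.range b0,
      |(∑ a ∈ Finset.range T, (p a b : ℝ) * (x : ℝ) ^ a) * th ^ (b * x)| ≤
      (T * P * (x : ℝ) ^ T) * th ^ ((b0 - 1) * x) := by
    intro b hb
    rw [Finset.mem_range] at hb
    rw [abs_mul, abs_of_pos (pow_pos hth0 (b * x))]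
    apply mul_le_mul
    · refine (Finset.abs_sum_le_sum_abs _ _).trans ?_
      have : ∀ a ∈ Finset.range T, |(p a b : ℝ) * (x : ℝ) ^ a| ≤ P * (x : ℝ) ^ T := by
        intro a ha
        rw [abs_mul, abs_of_nonneg (by positivity : (0 : ℝ) ≤ (x : ℝ) ^ a)]
        apply mul_le_mul (hP a b) (pow_le_pow_right₀ hx0 (Finset.mem_range.mp ha).le)
          (by positivity) hP0
      refine (Finset.sum_le_card_nsmul _ _ _ this).trans ?_
      simp [mul_assoc]
    · apply pow_le_pow_right₀ (by linarith)
      exact Nat.mul_le_mul_right _ (by omega)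
    · positivity
    · positivity
  have hsum := (Finset.abs_sum_le_sum_abs
    (fun b => (∑ a ∈ Finset.range T, (p a b : ℝ) * (x : ℝ) ^ a) * th ^ (b * x))
    (Finset.range b0)).trans (Finset.sum_le_card_nsmul _ _ _ hbnd)
  rw [eq_neg_of_add_eq_zero_left h0, abs_neg, abs_mul,
    abs_of_pos (pow_pos hth0 (b0 * x)), Finset.card_range, nsmul_eq_mul] at hsum
  have hlow : th ^ (b0 * x) ≤ |∑ a ∈ Finset.range T, (p a b0 : ℝ) * (x : ℝ) ^ a| * th ^ (b0 * x) :=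
    le_mul_of_one_le_left (by positivity) hone
  have h3 := hlow.trans hsum
  rcases Nat.eq_zero_or_pos b0 with hb | hb
  · rw [hb] at h3
    simp at h3
    linarith
  · have h4 : th ^ (b0 * x) = th ^ x * th ^ ((b0 - 1) * x) := by
      rw [← pow_add]; congr 1
      obtain ⟨c, rfl⟩ : ∃ c, b0 = c + 1 := ⟨b0 - 1, by omega⟩
      simp; ring
    rw [h4, ← mul_assoc] at h3
    have h5 := le_of_mul_le_mul_right h3 (pow_pos hth0 ((b0 - 1) * x))
    have h6 := hgr x hx.1 hx.2
    have h7 : (2 : ℝ) ^ x ≤ th ^ x := pow_le_pow_left₀ (by norm_num) hth x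
    have h8 : (b0 : ℝ) * (T * P * (x : ℝ) ^ T) ≤ (B : ℝ) * (T * P * (x : ℝ) ^ T) := by
      apply mul_le_mul_of_nonneg_right
      · exact_mod_cast hb0.le
      · positivity
    linarith

open Polynomial in
lemma lemA_single (w : ℤ√2) (j : ℕ) : ∃ q : (ℤ√2)[X], ∃ v : ℤ, ¬ (5 : ℤ) ∣ v ∧
    ∀ s : ℕ, q.eval (5 * (s : ℤ√2)) = (v : ℤ√2) * ((25 * w) ^ j * (s.choose j : ℤ√2)) := by
  have hf : j.factorial ≠ 0 := Nat.factorial_ne_zero j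
  obtain ⟨e, v, hv, hev⟩ := Nat.exists_eq_pow_mul_and_not_dvd hf 5 (by norm_num)
  have he : e ≤ j := by
    have : Fact (Nat.Prime 5) := ⟨Nat.prime_five⟩
    have h1 := sub_one_mul_padicValNat_factorial (p := 5) j
    have h2 : e ≤ padicValNat 5 j.factorial := by
      rw [← padicValNat_dvd_iff_le hf]
      exact ⟨v, hev⟩
    omega
  have hprod : ∀ s : ℕ, ∏ i ∈ Finset.range j, (5 * (s : ℤ√2) - 5 * (i : ℤ√2)) =
      5 ^ j * ((s.descFactorial j : ℕ) : ℤ√2) := by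
    intro s
    have : ∀ i ∈ Finset.range j, (5 * (s : ℤ√2) - 5 * (i : ℤ√2)) = 5 * ((s : ℤ√2) - i) := by
      intros; ring
    rw [Finset.prod_congr rfl this, Finset.prod_mul_distrib, Finset.prod_const, Finset.card_range]
    congr 1
    rcases Nat.lt_or_ge s j with h | h
    · rw [Nat.descFactorial_of_lt h, Nat.cast_zero]
      exact Finset.prod_eq_zero (Finset.mem_range.mpr h) (sub_self _)
    · rw [Nat.descFactorial_eq_prod_range, Nat.cast_prod]
      apply Finset.prod_congr rfl
      intro i hi
      rw [Finset.mem_range] at hi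
      rw [Nat.cast_sub (by omega)]
  refine ⟨C ((5 : ℤ√2) ^ (j - e) * w ^ j) * ∏ i ∈ Finset.range j, (X - C (5 * (i : ℤ√2))), v,
    by exact_mod_cast hv, ?_⟩
  intro s
  simp only [eval_mul, eval_C, eval_prod, eval_sub, eval_X]
  rw [hprod, Nat.descFactorial_eq_factorial_mul_choose, hev]
  push_cast
  have : (5 : ℤ√2) ^ j = 5 ^ (j - e) * 5 ^ e := by rw [← pow_add, Nat.sub_add_cancel he]
  rw [mul_pow, show (25 : ℤ√2) = 5 * 5 by norm_num, mul_pow]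
  nth_rewrite 3 [this]
  ring

open Polynomial in
lemma lemA_sum (w : ℤ√2) (N0 : ℕ) : ∃ q : (ℤ√2)[X], ∃ u : ℤ, ¬ (5 : ℤ) ∣ u ∧
    ∀ s : ℕ, q.eval (5 * (s : ℤ√2)) = (u : ℤ√2) *
      ∑ j ∈ Finset.range N0, ((25 * w) ^ j * (s.choose j : ℤ√2)) := by
  induction N0 with
  | zero => exact ⟨0, 1, by decide, by intro s; simp⟩
  | succ N ih =>
    obtain ⟨q, u, hu, hq⟩ := ih
    obtain ⟨r, v, hv, hr⟩ := lemA_single w N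
    have h5 : Prime (5 : ℤ) := by exact_mod_cast (Nat.prime_iff_prime_int.mp Nat.prime_five)
    refine ⟨C (v : ℤ√2) * q + C (u : ℤ√2) * r, u * v, ?_, ?_⟩
    · intro h
      rcases h5.dvd_or_dvd h with h | h
      · exact hu h
      · exact hv h
    · intro s
      rw [eval_add, eval_mul, eval_mul, eval_C, eval_C, hq, hr, Finset.sum_range_succ]
      push_cast
      ring

open Polynomial in
lemma lemA (w : ℤ√2) (N0 : ℕ) : ∃ q : (ℤ√2)[X], ∃ u : ℤ, ¬ (5 : ℤ) ∣ u ∧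
    ∀ s : ℕ, (5 : ℤ√2) ^ N0 ∣ (u : ℤ√2) * (1 + 25 * w) ^ s - q.eval (5 * (s : ℤ√2)) := by
  obtain ⟨q, u, hu, hq⟩ := lemA_sum w N0
  refine ⟨q, u, hu, ?_⟩
  intro s
  rw [hq, ← mul_sub]
  apply Dvd.dvd.mul_left
  have h1 : (1 + 25 * w) ^ s = ∑ j ∈ Finset.range (s + 1 + N0),
      ((25 * w) ^ j * (s.choose j : ℤ√2)) := by
    rw [add_comm, add_pow, Finset.sum_range_add _ (s + 1) N0]
    simp only [one_pow, mul_one]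
    symm
    apply add_eq_left.mpr
    apply Finset.sum_eq_zero
    intro i _
    rw [Nat.choose_eq_zero_of_lt (by omega)]; simp
  rw [h1, add_comm (s + 1), Finset.sum_range_add, add_sub_cancel_left]
  apply Finset.dvd_sum
  intro i _
  apply Dvd.dvd.mul_right
  rw [mul_pow]
  apply Dvd.dvd.mul_right
  rw [show (25 : ℤ√2) = 5 * 5 by norm_num, mul_pow, pow_add, mul_assoc]
  exact dvd_mul_right _ _

/-- The auxiliary exponential polynomial. -/
def auxF (p : ℕ → ℕ → ℤ) (T B : ℕ) (A : ℤ√2) (s : ℕ) : ℤ√2 :=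
  ∑ a ∈ Finset.range T, ∑ b ∈ Finset.range B, (p a b : ℤ√2) * (s : ℤ√2) ^ a * A ^ (b * s)

open Polynomial in
lemma interp (p : ℕ → ℕ → ℤ) (T B : ℕ) (w : ℤ√2) (L n : ℕ) (hL : 1 ≤ L) (I : Finset ℕ)
    (hn : L * I.card ≤ n) (hT : T ≤ I.card)
    (hI : ∀ s ∈ I, (5 : ℤ√2) ^ n ∣ auxF p T B (1 + 25 * w) s)
    (hd : ∀ s ∈ I, ∀ t ∈ I, s ≠ t → ¬ (5 : ℤ) ^ L ∣ (s : ℤ) - t) (t : ℕ) :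
    (5 : ℤ√2) ^ (I.card - T) ∣ auxF p T B (1 + 25 * w) t := by
  obtain ⟨q, u, hu, hq⟩ := lemA w n
  set G : (ℤ√2)[X] := ∑ a ∈ Finset.range T, ∑ b ∈ Finset.range B,
    C ((p a b : ℤ√2) * 5 ^ (T - a)) * X ^ a * q.comp (C (b : ℤ√2) * X) with hG
  have hGe : ∀ s : ℕ, (5 : ℤ√2) ^ n ∣
      (5 ^ T * (u * auxF p T B (1 + 25 * w) s)) - G.eval (5 * (s : ℤ√2)) := by
    intro s
    rw [hG, auxF, eval_finsetSum, Finset.mul_sum, Finset.mul_sum, ← Finset.sum_sub_distrib]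
    apply Finset.dvd_sum
    intro a ha
    rw [Finset.mem_range] at ha
    rw [eval_finsetSum, Finset.mul_sum, Finset.mul_sum, ← Finset.sum_sub_distrib]
    apply Finset.dvd_sum
    intro b _
    simp only [eval_mul, eval_C, eval_pow, eval_X, eval_comp]
    have h1 := hq (b * s)
    have h2 : (5 : ℤ√2) ^ T = 5 ^ (T - a) * 5 ^ a := by
      rw [← pow_add, Nat.sub_add_cancel ha.le]
    have h3 : (b : ℤ√2) * (5 * (s : ℤ√2)) = 5 * ((b * s : ℕ) : ℤ√2) := by push_cast; ring
    rw [h3, h2]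
    have h4 : (5 : ℤ√2) ^ (T - a) * 5 ^ a * (u * ((p a b : ℤ√2) * (s : ℤ√2) ^ a *
        (1 + 25 * w) ^ (b * s))) - (p a b : ℤ√2) * 5 ^ (T - a) * (5 * (s : ℤ√2)) ^ a *
        q.eval (5 * ((b * s : ℕ) : ℤ√2)) =
        (5 ^ (T - a) * 5 ^ a * (p a b : ℤ√2) * (s : ℤ√2) ^ a) *
        (u * (1 + 25 * w) ^ (b * s) - q.eval (5 * ((b * s : ℕ) : ℤ√2))) := by
      rw [mul_pow]; ring
    rw [h4]
    exact h1.mul_left _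
  set J : Finset ℤ := I.image (fun n : ℕ => (n : ℤ)) with hJ
  have hJc : J.card = I.card := Finset.card_image_of_injective _ Nat.cast_injective
  have hB := lemB L hL J n G (by rw [hJc]; exact hn) (by
    intro s hs
    obtain ⟨s', hs', rfl⟩ := Finset.mem_image.mp hs
    have h1 := (hI s' hs').mul_left (5 ^ T * (u : ℤ√2))
    rw [mul_assoc] at h1
    have h2 := (dvd_sub_right h1).mp (hGe s')
    simpa using h2) (by
    intro s hs t ht
    obtain ⟨s', hs', rfl⟩ := Finset.mem_image.mp hs
    obtain ⟨t', ht', rfl⟩ := Finset.mem_image.mp ht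
    intro hne
    exact hd s' hs' t' ht' (by rintro rfl; exact hne rfl)) (t : ℤ)
  rw [hJc] at hB
  apply cop_cancel u hu
  have h1 : (5 : ℤ√2) ^ I.card ∣ 5 ^ T * (u * auxF p T B (1 + 25 * w) t) := by
    have h2 : (5 : ℤ√2) ^ I.card ∣ 5 ^ n := pow_dvd_pow 5 (by nlinarith)
    have h3 := h2.trans (hGe t)
    push_cast at hB
    exact (dvd_sub_left hB).mp h3
  have h2 : (5 : ℤ√2) ^ T * 5 ^ (I.card - T) ∣ 5 ^ T * (u * auxF p T B (1 + 25 * w) t) := by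
    rw [← pow_add, Nat.add_sub_cancel' hT]; exact h1
  exact (mul_dvd_mul_iff_left (pow_ne_zero _ five_ne_zero_R)).mp h2

/-- Size on `ℤ√2`. -/
def nR (z : ℤ√2) : ℕ := z.re.natAbs + 2 * z.im.natAbs

lemma nR_add (z w : ℤ√2) : nR (z + w) ≤ nR z + nR w := by
  unfold nR
  simp only [Zsqrtd.re_add, Zsqrtd.im_add]
  omega

lemma nR_mul (z w : ℤ√2) : nR (z * w) ≤ nR z * nR w := by
  unfold nR
  simp only [Zsqrtd.re_mul, Zsqrtd.im_mul]
  have h1 := Int.natAbs_add_le (z.re * w.re) (2 * z.im * w.im)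
  have h2 := Int.natAbs_add_le (z.re * w.im) (z.im * w.re)
  simp only [Int.natAbs_mul] at h1 h2
  have : Int.natAbs 2 = 2 := rfl
  rw [this] at h1
  nlinarith [Nat.zero_le (z.im.natAbs * w.im.natAbs)]

lemma nR_natCast (a : ℕ) : nR (a : ℤ√2) = a := by simp [nR]
lemma nR_intCast (a : ℤ) : nR (a : ℤ√2) = a.natAbs := by simp [nR]

/-- The quadratic extension ring. -/
abbrev SS (E : ℕ) := QuadraticAlgebra (ℤ√2) (E : ℤ√2) 0

/-- Size on the quadratic extension. -/
def nS {E : ℕ} (e : ℕ) (v : SS E) : ℕ := nR v.re + e * nR v.im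

lemma nS_add {E : ℕ} (e : ℕ) (v w : SS E) : nS e (v + w) ≤ nS e v + nS e w := by
  unfold nS
  simp only [QuadraticAlgebra.re_add, QuadraticAlgebra.im_add]
  have h1 := nR_add v.re w.re
  have h2 := Nat.mul_le_mul_left e (nR_add v.im w.im)
  nlinarith

lemma nS_mul {E : ℕ} (e : ℕ) (he : E ≤ e * e) (v w : SS E) :
    nS e (v * w) ≤ nS e v * nS e w := by
  unfold nS
  simp only [QuadraticAlgebra.re_mul, QuadraticAlgebra.im_mul, zero_mul, add_zero]
  have h1 := nR_add (v.re * w.re) ((E : ℤ√2) * v.im * w.im)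
  have h2 := nR_add (v.re * w.im) (v.im * w.re)
  have h3 := nR_mul v.re w.re
  have h4 := nR_mul v.re w.im
  have h5 := nR_mul v.im w.re
  have h6 : nR ((E : ℤ√2) * v.im * w.im) ≤ e * e * (nR v.im * nR w.im) := by
    rw [mul_assoc]
    refine (nR_mul _ _).trans ?_
    rw [nR_natCast]
    exact Nat.mul_le_mul he (nR_mul _ _)
  have h7 := Nat.mul_le_mul_left e (h2.trans (Nat.add_le_add h4 h5))
  nlinarith

lemma nS_one {E : ℕ} (e : ℕ) : nS e (1 : SS E) = 1 := by
  simp [nS, nR, QuadraticAlgebra.re_one, QuadraticAlgebra.im_one]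

lemma nS_pow {E : ℕ} (e : ℕ) (he : E ≤ e * e) (v : SS E) (j : ℕ) :
    nS e (v ^ j) ≤ nS e v ^ j := by
  induction j with
  | zero => simp [nS_one]
  | succ j ih =>
    rw [pow_succ, pow_succ]
    exact (nS_mul e he _ _).trans (Nat.mul_le_mul_right _ ih)

lemma nS_natCast {E : ℕ} (e a : ℕ) : nS e (a : SS E) = a := by
  simp [nS, nR]

lemma nS_intCast {E : ℕ} (e : ℕ) (a : ℤ) : nS e (a : SS E) = a.natAbs := by
  simp [nS, nR]

lemma nS_sum {E : ℕ} (e : ℕ) {ι : Type} (s : Finset ι) (f : ι → SS E) :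
    nS e (∑ i ∈ s, f i) ≤ ∑ i ∈ s, nS e (f i) := by
  classical
  induction s using Finset.induction_on with
  | empty => simp [nS, nR]
  | insert a s ha ih =>
    rw [Finset.sum_insert ha, Finset.sum_insert ha]
    exact (nS_add e _ _).trans (Nat.add_le_add_left ih _)

lemma norm_le_nR (z : ℤ√2) : (Zsqrtd.norm z).natAbs ≤ nR z ^ 2 := by
  unfold nR
  rw [Zsqrtd.norm_def]
  have h1 := Int.natAbs_sub_le (z.re * z.re) (2 * z.im * z.im)
  simp only [Int.natAbs_mul] at h1
  have : Int.natAbs 2 = 2 := rfl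
  rw [this] at h1
  nlinarith [Nat.zero_le (z.re.natAbs * z.im.natAbs), Nat.zero_le (z.im.natAbs * z.im.natAbs)]

/-- Evaluation of `η` at an approximate square root. -/
def phi {E : ℕ} (h : ℤ√2) (v : SS E) : ℤ√2 := v.re + h * v.im

lemma phi_add {E : ℕ} (h : ℤ√2) (v w : SS E) : phi h (v + w) = phi h v + phi h w := by
  simp only [phi, QuadraticAlgebra.re_add, QuadraticAlgebra.im_add]; ring

/-- `phi` followed by reduction is a ring homomorphism -/
def phiHom {E : ℕ} (h : ℤ√2) (J : Ideal (ℤ√2)) (hJ : h * h - (E : ℤ√2) ∈ J) :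
    SS E →+* (ℤ√2) ⧸ J where
  toFun v := Ideal.Quotient.mk J (phi h v)
  map_one' := by simp [phi, QuadraticAlgebra.re_one, QuadraticAlgebra.im_one]
  map_zero' := by simp [phi]
  map_add' v w := by rw [phi_add, map_add]
  map_mul' v w := by
    rw [← map_mul, Ideal.Quotient.eq]
    have : phi h (v * w) - phi h v * phi h w = (h * h - (E : ℤ√2)) * (- (v.im * w.im)) := by
      simp only [phi, QuadraticAlgebra.re_mul, QuadraticAlgebra.im_mul]; ring
    rw [this]
    exact J.mul_mem_right _ hJ

lemma vanish {E : ℕ} (e : ℕ) (he : E ≤ e * e) (h : ℤ√2) (M : ℕ)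
    (hE : (5 : ℤ√2) ^ M ∣ h * h - (E : ℤ√2))
    (hns : ∀ p q : ℤ√2, p * p = (E : ℤ√2) * (q * q) → p = 0 ∧ q = 0)
    (v : SS E) (hv : (5 : ℤ√2) ^ M ∣ phi h v) (hsz : nS e v ^ 4 < 5 ^ (2 * M)) : v = 0 := by
  set w := v.re * v.re - (E : ℤ√2) * (v.im * v.im) with hw
  have hdvd : (5 : ℤ√2) ^ M ∣ w := by
    have : w = phi h v * (v.re - h * v.im) + (h * h - (E : ℤ√2)) * (v.im * v.im) := by
      rw [hw, phi]; ring
    rw [this]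
    exact dvd_add (hv.mul_right _) (hE.mul_right _)
  have hnw : nR w ≤ nS e v ^ 2 := by
    have h1 : nR w ≤ nR (v.re * v.re) + nR ((E : ℤ√2) * (v.im * v.im)) := by
      have hneg : ∀ z : ℤ√2, nR (-z) = nR z := by
        intro z; simp [nR]
      rw [hw, sub_eq_add_neg, ← hneg ((E : ℤ√2) * (v.im * v.im))]
      exact nR_add _ _
    have h2 := nR_mul v.re v.re
    have h3 : nR ((E : ℤ√2) * (v.im * v.im)) ≤ e * e * (nR v.im * nR v.im) := by
      refine (nR_mul _ _).trans ?_
      rw [nR_natCast]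
      exact Nat.mul_le_mul he (nR_mul _ _)
    unfold nS
    nlinarith [Nat.zero_le (nR v.re * (e * nR v.im))]
  have hnorm : (Zsqrtd.norm w).natAbs ≤ nS e v ^ 4 := by
    refine (norm_le_nR w).trans ?_
    calc nR w ^ 2 ≤ (nS e v ^ 2) ^ 2 := Nat.pow_le_pow_left hnw 2
      _ = nS e v ^ 4 := by ring
  have hd2 : 5 ^ (2 * M) ∣ (Zsqrtd.norm w).natAbs := by
    obtain ⟨z, hz⟩ := hdvd
    have : Zsqrtd.norm w = 5 ^ (2 * M) * Zsqrtd.norm z := by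
      rw [hz, Zsqrtd.norm_mul]
      congr 1
      have : (5 : ℤ√2) ^ M = ((5 ^ M : ℤ) : ℤ√2) := by push_cast; rfl
      rw [this, Zsqrtd.norm_intCast]
      ring
    rw [this, Int.natAbs_mul]
    apply Dvd.dvd.mul_right
    rw [Int.natAbs_pow]
    exact dvd_rfl
  have hzero : Zsqrtd.norm w = 0 := by
    have := Nat.eq_zero_of_dvd_of_lt hd2 (hnorm.trans_lt hsz)
    exact Int.natAbs_eq_zero.mp this
  have hw0 : w = 0 := (Zsqrtd.norm_eq_zero not_square_two w).mp hzero
  have := hns v.re v.im (sub_eq_zero.mp (hw ▸ hw0))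
  exact QuadraticAlgebra.ext this.1 this.2

/-- Monomials of the auxiliary function. -/
def mon {E : ℕ} (A : ℤ√2) (z : SS E) (B k1 x y a b : ℕ) : SS E :=
  ((x + k1 * y : ℕ) : SS E) ^ a * (QuadraticAlgebra.C A) ^ (b * x) * z ^ (b * y) *
    9 ^ ((B - 1 - b) * y)

/-- The auxiliary values. -/
def vv {E : ℕ} (p : ℕ → ℕ → ℤ) (T : ℕ) (A : ℤ√2) (z : SS E) (B k1 x y : ℕ) : SS E :=
  ∑ a ∈ Finset.range T, ∑ b ∈ Finset.range B, (p a b : SS E) * mon A z B k1 x y a b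

lemma phi_vv {E : ℕ} (p : ℕ → ℕ → ℤ) (T : ℕ) (A : ℤ√2) (z : SS E) (B k1 x y : ℕ)
    (h : ℤ√2) (n : ℕ) (hE : (5 : ℤ√2) ^ n ∣ h * h - (E : ℤ√2))
    (hz : (5 : ℤ√2) ^ n ∣ phi h z - 9 * A ^ k1) :
    (5 : ℤ√2) ^ n ∣ phi h (vv p T A z B k1 x y) -
      9 ^ ((B - 1) * y) * auxF p T B A (x + k1 * y) := by
  set J : Ideal (ℤ√2) := Ideal.span {(5 : ℤ√2) ^ n} with hJ
  have hEJ : h * h - (E : ℤ√2) ∈ J := Ideal.mem_span_singleton.mpr hE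
  set F := phiHom h J hEJ with hF
  have hFv : ∀ v : SS E, F v = Ideal.Quotient.mk J (phi h v) := fun v => rfl
  have hFA : F (QuadraticAlgebra.C A) = Ideal.Quotient.mk J A := by
    rw [hFv]; simp [phi]
  have hFz : F z = Ideal.Quotient.mk J (9 * A ^ k1) := by
    rw [hFv, Ideal.Quotient.eq]
    exact Ideal.mem_span_singleton.mpr hz
  have key : F (vv p T A z B k1 x y) = Ideal.Quotient.mk J
      (9 ^ ((B - 1) * y) * auxF p T B A (x + k1 * y)) := by
    simp only [vv, auxF, Finset.mul_sum, map_sum]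
    apply Finset.sum_congr rfl
    intro a _
    apply Finset.sum_congr rfl
    intro b hb
    rw [Finset.mem_range] at hb
    simp only [mon, map_mul, map_pow, map_intCast, map_natCast, hFA, hFz, map_ofNat]
    have h1 : (B - 1) * y = (B - 1 - b) * y + b * y := by
      rw [← add_mul]; congr 1; omega
    rw [h1]
    simp only [mul_pow, pow_add, mul_add, ← pow_mul]
    rw [show k1 * (b * y) = b * (k1 * y) by ring]
    ring
  rw [hFv, Ideal.Quotient.eq] at key
  exact Ideal.mem_span_singleton.mp key

lemma nS_mon {E : ℕ} (e : ℕ) (he : E ≤ e * e) (A : ℤ√2) (z : SS E) (l T B k1 X Y x y a b : ℕ)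
    (hA : nR A ≤ 2 ^ 77) (hz : nS e z ≤ 2 ^ (5 * l)) (hl : 1 ≤ l)
    (hs : x + k1 * y ≤ 2 ^ (2 * l)) (hx : x ≤ X) (hy : y ≤ Y) (ha : a < T) (hb : b < B) :
    nS e (mon A z B k1 x y a b) ≤ 2 ^ (2 * l * T + 77 * B * X + 5 * l * B * Y) := by
  have h1 : nS e (((x + k1 * y : ℕ) : SS E) ^ a) ≤ 2 ^ (2 * l * a) := by
    refine (nS_pow e he _ _).trans ?_
    rw [nS_natCast, pow_mul]
    exact Nat.pow_le_pow_left hs a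
  have h2 : nS e ((QuadraticAlgebra.C A : SS E) ^ (b * x)) ≤ 2 ^ (77 * (b * x)) := by
    refine (nS_pow e he _ _).trans ?_
    rw [pow_mul 2 77]
    apply Nat.pow_le_pow_left
    simpa [nS, nR] using hA
  have h3 : nS e (z ^ (b * y)) ≤ 2 ^ (5 * l * (b * y)) := by
    refine (nS_pow e he _ _).trans ?_
    rw [pow_mul 2 (5 * l)]
    exact Nat.pow_le_pow_left hz _
  have h4 : nS e ((9 : SS E) ^ ((B - 1 - b) * y)) ≤ 2 ^ (5 * l * ((B - 1 - b) * y)) := by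
    refine (nS_pow e he _ _).trans ?_
    rw [pow_mul 2 (5 * l)]
    apply Nat.pow_le_pow_left
    have : nS e (9 : SS E) = 9 := by exact_mod_cast nS_natCast e 9
    rw [this]
    calc 9 ≤ 2 ^ 5 := by norm_num
      _ ≤ 2 ^ (5 * l) := Nat.pow_le_pow_right (by norm_num) (by omega)
  have h5 := nS_mul e he (((x + k1 * y : ℕ) : SS E) ^ a) ((QuadraticAlgebra.C A : SS E) ^ (b * x))
  have h6 := nS_mul e he (((x + k1 * y : ℕ) : SS E) ^ a * (QuadraticAlgebra.C A : SS E) ^ (b * x))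
    (z ^ (b * y))
  have h7 := nS_mul e he (((x + k1 * y : ℕ) : SS E) ^ a * (QuadraticAlgebra.C A : SS E) ^ (b * x) *
    (z ^ (b * y))) ((9 : SS E) ^ ((B - 1 - b) * y))
  unfold mon
  have h8 : 2 ^ (2 * l * a) * 2 ^ (77 * (b * x)) * 2 ^ (5 * l * (b * y)) *
      2 ^ (5 * l * ((B - 1 - b) * y)) ≤ 2 ^ (2 * l * T + 77 * B * X + 5 * l * B * Y) := by
    rw [← pow_add, ← pow_add, ← pow_add]
    apply Nat.pow_le_pow_right (by norm_num)
    have e1 : 2 * l * a ≤ 2 * l * T := Nat.mul_le_mul_left _ ha.le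
    have e2 : 77 * (b * x) ≤ 77 * B * X := by
      rw [mul_assoc]; exact Nat.mul_le_mul_left _ (Nat.mul_le_mul hb.le hx)
    have e3 : 5 * l * (b * y) + 5 * l * ((B - 1 - b) * y) ≤ 5 * l * B * Y := by
      rw [← mul_add, ← add_mul, mul_assoc (5 * l)]
      exact Nat.mul_le_mul_left _ (Nat.mul_le_mul (by omega) hy)
    omega
  calc _ ≤ _ := h7
    _ ≤ _ := Nat.mul_le_mul (h6.trans (Nat.mul_le_mul (h5.trans (Nat.mul_le_mul h1 h2)) h3)) h4
    _ ≤ _ := h8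

lemma nS_vv {E : ℕ} (e : ℕ) (he : E ≤ e * e) (p : ℕ → ℕ → ℤ) (A : ℤ√2) (z : SS E)
    (l T B k1 X Y x y P : ℕ) (hP : ∀ a b, (p a b).natAbs ≤ P)
    (hA : nR A ≤ 2 ^ 77) (hz : nS e z ≤ 2 ^ (5 * l)) (hl : 1 ≤ l)
    (hs : x + k1 * y ≤ 2 ^ (2 * l)) (hx : x ≤ X) (hy : y ≤ Y) :
    nS e (vv p T A z B k1 x y) ≤
      T * (B * (P * 2 ^ (2 * l * T + 77 * B * X + 5 * l * B * Y))) := by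
  unfold vv
  refine (nS_sum e _ _).trans ?_
  refine (Finset.sum_le_card_nsmul _ _ _ (fun a ha => ?_)).trans (le_of_eq (by
    rw [Finset.card_range, smul_eq_mul]))
  refine (nS_sum e _ _).trans ?_
  refine (Finset.sum_le_card_nsmul _ _ _ (fun b hb => ?_)).trans (le_of_eq (by
    rw [Finset.card_range, smul_eq_mul]))
  refine (nS_mul e he _ _).trans ?_
  rw [nS_intCast]
  exact Nat.mul_le_mul (hP a b) (nS_mon e he A z l T B k1 X Y x y a b hA hz hl hs hx hy
    (Finset.mem_range.mp ha) (Finset.mem_range.mp hb))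

/-- Integer coordinates on the quadratic extension. -/
def cdF {E : ℕ} (i : Fin 4) (v : SS E) : ℤ :=
  if i = 0 then v.re.re else if i = 1 then v.re.im else if i = 2 then v.im.re else v.im.im

lemma cdF_add {E : ℕ} (i : Fin 4) (v w : SS E) : cdF i (v + w) = cdF i v + cdF i w := by
  fin_cases i <;> simp [cdF]

/-- Integer coordinates as additive maps. -/
def cd {E : ℕ} (i : Fin 4) : SS E →+ ℤ := AddMonoidHom.mk' (cdF i) (cdF_add i)

lemma cd_le {E : ℕ} (e : ℕ) (he : 1 ≤ e) (i : Fin 4) (v : SS E) : |cd i v| ≤ (nS e v : ℤ) := by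
  have : nR v.im ≤ e * nR v.im := Nat.le_mul_of_pos_left _ he
  have h2 : nR v.re + nR v.im ≤ nS e v := by unfold nS; omega
  have h3 : (nR v.re : ℤ) + nR v.im ≤ nS e v := by exact_mod_cast h2
  refine le_trans ?_ h3
  have n1 := abs_nonneg v.re.re
  have n2 := abs_nonneg v.re.im
  have n3 := abs_nonneg v.im.re
  have n4 := abs_nonneg v.im.im
  fin_cases i <;> simp [cd, cdF, nR] <;> linarith

lemma cd_zero {E : ℕ} (v : SS E) (h : ∀ i, cd i v = 0) : v = 0 := by
  have h0 := h 0
  have h1 := h 1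
  have h2 := h 2
  have h3 := h 3
  simp [cd, cdF] at h0 h1 h2 h3
  apply QuadraticAlgebra.ext
  · exact Zsqrtd.ext h0 h1
  · exact Zsqrtd.ext h2 h3

lemma siegel_vv {E : ℕ} (e : ℕ) (he : 1 ≤ e) (A : ℤ√2) (z : SS E) (T B k1 X0 Y U : ℕ)
    (hTB : T * B = 2 * (X0 * Y * 4)) (hX0 : 0 < X0) (hY : 0 < Y) (hU : 1 ≤ U)
    (hm : ∀ x < X0, ∀ y < Y, ∀ a < T, ∀ b < B, nS e (mon A z B k1 x y a b) ≤ U) :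
    ∃ p : ℕ → ℕ → ℤ, (∃ b < B, ∃ a < T, p a b ≠ 0) ∧
      (∀ x < X0, ∀ y < Y, vv p T A z B k1 x y = 0) ∧
      ∀ a b, (p a b).natAbs ≤ T * B * U := by
  obtain ⟨t, ht, hz, hb⟩ := siegel_aux (ι := (Fin X0 × Fin Y) × Fin 4) (κ := Fin T × Fin B)
    (by simpa using hTB) (by simp only [Fintype.card_prod, Fintype.card_fin]; positivity)
    (fun i j => cd i.2 (mon A z B k1 i.1.1 i.1.2 j.1 j.2)) U hU (by
      intro i j
      refine (cd_le e he _ _).trans ?_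
      exact_mod_cast hm _ i.1.1.2 _ i.1.2.2 _ j.1.2 _ j.2.2)
  refine ⟨fun a b => if h : a < T ∧ b < B then t (⟨a, h.1⟩, ⟨b, h.2⟩) else 0, ?_, ?_, ?_⟩
  · obtain ⟨j, hj⟩ := Function.ne_iff.mp ht
    refine ⟨j.2, j.2.2, j.1, j.1.2, ?_⟩
    simpa using hj
  · intro x hx y hy
    apply cd_zero
    intro i
    have := hz ((⟨x, hx⟩, ⟨y, hy⟩), i)
    rw [Fintype.sum_prod_type] at this
    rw [vv, Finset.sum_range, map_sum, ← this]
    apply Finset.sum_congr rfl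
    intro a _
    rw [Finset.sum_range, map_sum]
    apply Finset.sum_congr rfl
    intro b _
    simp only [Fin.is_lt, and_self, dite_true, Fin.eta]
    rw [← zsmul_eq_mul, map_zsmul, smul_eq_mul, mul_comm]
  · intro a b
    simp only
    split_ifs with h
    · have := hb (⟨a, h.1⟩, ⟨b, h.2⟩)
      simp only [Fintype.card_prod, Fintype.card_fin] at this
      zify
      exact_mod_cast this
    · simp

lemma step {E : ℕ} (e : ℕ) (he : E ≤ e * e) (h : ℤ√2) (n : ℕ)
    (hE : (5 : ℤ√2) ^ n ∣ h * h - (E : ℤ√2))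
    (hns : ∀ p q : ℤ√2, p * p = (E : ℤ√2) * (q * q) → p = 0 ∧ q = 0)
    (w : ℤ√2) (z : SS E) (k1 l : ℕ)
    (hz : (5 : ℤ√2) ^ n ∣ phi h z - 9 * (1 + 25 * w) ^ k1)
    (hA : nR (1 + 25 * w) ≤ 2 ^ 77) (hzs : nS e z ≤ 2 ^ (5 * l)) (hl : 1 ≤ l)
    (p : ℕ → ℕ → ℤ) (T B X Y P : ℕ) (hP : ∀ a b, (p a b).natAbs ≤ P)
    (hX : X < k1) (hk1 : k1 ≤ 2 ^ l) (hY : Y ≤ 2 ^ l) (hn : l * (X * Y) ≤ n)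
    (hTM : T < X * Y)
    (hsz : T * (B * (P * 2 ^ (2 * l * T + 77 * B * X + 5 * l * B * Y))) ≤ 2 ^ (X * Y - T))
    (hv : ∀ x < X, ∀ y < Y, vv p T (1 + 25 * w) z B k1 x y = 0) :
    ∀ y < Y, vv p T (1 + 25 * w) z B k1 X y = 0 := by
  intro y hy
  have hbd : ∀ x ≤ X, ∀ y < Y, x + k1 * y < 2 ^ (2 * l) := by
    intro x hx y hy
    calc x + k1 * y < k1 * (y + 1) := by rw [mul_add]; omega
      _ ≤ 2 ^ l * 2 ^ l := Nat.mul_le_mul hk1 (by omega)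
      _ = 2 ^ (2 * l) := by rw [← pow_add]; congr 1; ring
  set I : Finset ℕ := (Finset.range X ×ˢ Finset.range Y).image (fun q => q.1 + k1 * q.2) with hI
  have hcard : I.card = X * Y := by
    rw [hI, Finset.card_image_of_injOn, Finset.card_product, Finset.card_range, Finset.card_range]
    rintro ⟨x1, y1⟩ h1 ⟨x2, y2⟩ h2 heq
    simp only [Finset.coe_product, Finset.coe_range, Set.mem_prod, Set.mem_Iio] at h1 h2 heq
    have e1 : x1 = x2 := by
      have := congrArg (· % k1) heq
      simp only [Nat.add_mul_mod_self_left] at this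
      rwa [Nat.mod_eq_of_lt (by omega), Nat.mod_eq_of_lt (by omega)] at this
    subst e1
    have e2 : y1 = y2 := Nat.eq_of_mul_eq_mul_left (show 0 < k1 by omega) (by omega)
    rw [e2]
  have hIlt : ∀ s ∈ I, s < 2 ^ (2 * l) := by
    intro s hs
    obtain ⟨q, hq, rfl⟩ := Finset.mem_image.mp hs
    rw [Finset.mem_product, Finset.mem_range, Finset.mem_range] at hq
    exact hbd _ hq.1.le _ hq.2
  have h45 : 2 ^ (2 * l) ≤ 5 ^ l := by
    rw [pow_mul]; exact Nat.pow_le_pow_left (by norm_num) l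
  have hint := interp p T B w l n hl I (by rw [hcard]; exact hn) (by rw [hcard]; exact hTM.le) (by
      intro s hs
      obtain ⟨q, hq, rfl⟩ := Finset.mem_image.mp hs
      rw [Finset.mem_product, Finset.mem_range, Finset.mem_range] at hq
      have h1 := phi_vv p T (1 + 25 * w) z B k1 q.1 q.2 h n hE hz
      rw [hv _ hq.1 _ hq.2] at h1
      have h2 : phi h (0 : SS E) = 0 := by simp [phi]
      rw [h2, zero_sub, dvd_neg] at h1
      apply cop_cancel (9 ^ ((B - 1) * q.2)) _ n
      · push_cast; exact h1
      · intro hd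
        have h5 : Prime (5 : ℤ) := by exact_mod_cast (Nat.prime_iff_prime_int.mp Nat.prime_five)
        have := h5.dvd_of_dvd_pow hd
        omega) (by
      intro s hs t ht hne hd
      have h1 := hIlt s hs
      have h2 := hIlt t ht
      have h3 : |(s : ℤ) - t| < 5 ^ l := by
        have h6 : s < 5 ^ l := by omega
        have h7 : t < 5 ^ l := by omega
        have h8 : (s : ℤ) < 5 ^ l := by exact_mod_cast h6
        have h9 : (t : ℤ) < 5 ^ l := by exact_mod_cast h7
        rw [abs_lt]
        constructor <;> omega
      have := Int.eq_zero_of_abs_lt_dvd hd h3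
      omega) (X + k1 * y)
  rw [hcard] at hint
  have hMn : X * Y - T ≤ n := by nlinarith [Nat.sub_le (X * Y) T]
  have hphi : (5 : ℤ√2) ^ (X * Y - T) ∣ phi h (vv p T (1 + 25 * w) z B k1 X y) := by
    have h1 := (pow_dvd_pow (5 : ℤ√2) hMn).trans
      (phi_vv p T (1 + 25 * w) z B k1 X y h n hE hz)
    exact (dvd_sub_left (hint.mul_left _)).mp h1
  refine vanish e he h (X * Y - T) ((pow_dvd_pow (5 : ℤ√2) hMn).trans hE) hns _ hphi ?_
  have h1 := (nS_vv e he p (1 + 25 * w) z l T B k1 X Y X y P hP hA hzs hl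
    (hbd X le_rfl y hy).le le_rfl hy.le).trans hsz
  calc _ ≤ (2 ^ (X * Y - T)) ^ 4 := Nat.pow_le_pow_left h1 4
    _ = 4 ^ (2 * (X * Y - T)) := by
        rw [← pow_mul, show (4 : ℕ) = 2 ^ 2 by norm_num, ← pow_mul]; congr 1; ring
    _ < 5 ^ (2 * (X * Y - T)) := Nat.pow_lt_pow_left (by norm_num) (by omega)

lemma vv_zero_y {E : ℕ} (p : ℕ → ℕ → ℤ) (T : ℕ) (A : ℤ√2) (z : SS E) (B k1 x : ℕ) :
    vv p T A z B k1 x 0 = algebraMap (ℤ√2) (SS E) (auxF p T B A x) := by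
  simp only [vv, auxF, mon, map_sum, map_mul, map_pow, map_intCast, map_natCast,
    QuadraticAlgebra.C_eq_algebraMap, mul_zero, add_zero, pow_zero, mul_one]
  apply Finset.sum_congr rfl
  intro a _
  apply Finset.sum_congr rfl
  intro b _
  ring

lemma pow_cubic (l : ℕ) (hl : 90 ≤ l) : 8 * 10 ^ 9 * l ^ 3 ≤ 2 ^ l := by
  induction l, hl using Nat.le_induction with
  | base => norm_num
  | succ l hl ih =>
    rw [pow_succ 2]
    nlinarith [Nat.zero_le (l ^ 2), Nat.mul_le_mul_right (l ^ 2) hl, Nat.mul_le_mul_right l hl]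

lemma transc {E : ℕ} (e : ℕ) (he1 : 1 ≤ e) (he : E ≤ e * e) (h : ℤ√2) (n : ℕ)
    (hE : (5 : ℤ√2) ^ n ∣ h * h - (E : ℤ√2))
    (hns : ∀ p q : ℤ√2, p * p = (E : ℤ√2) * (q * q) → p = 0 ∧ q = 0)
    (w : ℤ√2) (z : SS E) (k1 l : ℕ)
    (hz : (5 : ℤ√2) ^ n ∣ phi h z - 9 * (1 + 25 * w) ^ k1)
    (hA : nR (1 + 25 * w) ≤ 2 ^ 77) (hzs : nS e z ≤ 2 ^ (5 * l)) (hl : 90 ≤ l)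
    (f : ℤ√2 →+* ℝ) (hf : 2 ≤ f (1 + 25 * w))
    (hk1 : k1 ≤ 2 ^ l) (hk2 : 6 * 10 ^ 8 * l ^ 3 ≤ k1)
    (hn : l * (6 * 10 ^ 8 * l ^ 3 * (10 ^ 5 * l)) ≤ n) : False := by
  obtain ⟨T, hT⟩ : ∃ T, T = 8 * 10 ^ 7 * l ^ 2 := ⟨_, rfl⟩
  obtain ⟨B, hB⟩ : ∃ B, B = 100 * l := ⟨_, rfl⟩
  obtain ⟨Y, hY⟩ : ∃ Y, Y = 10 ^ 5 * l := ⟨_, rfl⟩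
  obtain ⟨X0, hX0⟩ : ∃ X0, X0 = 10 ^ 4 * l ^ 2 := ⟨_, rfl⟩
  obtain ⟨x1, hx1⟩ : ∃ x1, x1 = 5 * 10 ^ 8 * l ^ 3 := ⟨_, rfl⟩
  have hcub := pow_cubic l hl
  have hTB : T * B = 8 * 10 ^ 9 * l ^ 3 := by rw [hT, hB]; ring
  have hTBl : T * B ≤ 2 ^ l := by rw [hTB]; exact hcub
  have hl3 : 90 * l ^ 2 ≤ l ^ 3 := by rw [pow_succ' l 2]; exact Nat.mul_le_mul_right _ hl
  have hl2 : 90 * l ≤ l ^ 2 := by rw [pow_succ' l 1, pow_one]; exact Nat.mul_le_mul_right _ hl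
  have hYl : Y ≤ 2 ^ l := by omega
  have hxf : x1 + T ≤ 6 * 10 ^ 8 * l ^ 3 := by omega
  obtain ⟨Q, hQ⟩ : ∃ Q, Q = 2 * l * T + 77 * B * X0 + 5 * l * B * Y := ⟨_, rfl⟩
  have hQv : Q = 287 * 10 ^ 6 * l ^ 3 := by rw [hQ, hT, hB, hX0, hY]; ring
  obtain ⟨p, hpne, hp0, hpb⟩ := siegel_vv e he1 (1 + 25 * w) z T B k1 X0 Y (2 ^ Q)
    (by rw [hTB, hX0, hY]; ring) (by rw [hX0]; positivity) (by rw [hY]; positivity)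
    Nat.one_le_two_pow (by
      intro x hx y hy a ha b hb
      rw [hQ]
      refine nS_mon e he _ z l T B k1 X0 Y x y a b hA hzs (by omega) ?_ hx.le hy.le ha hb
      have : x ≤ k1 := by omega
      calc x + k1 * y ≤ k1 * (y + 1) := by rw [mul_add]; omega
        _ ≤ 2 ^ l * 2 ^ l := Nat.mul_le_mul hk1 (by omega)
        _ = 2 ^ (2 * l) := by rw [← pow_add]; congr 1; ring)
  -- extrapolation
  have hext : ∀ X, X0 ≤ X → X ≤ x1 + T →
      ∀ x < X, ∀ y < Y, vv p T (1 + 25 * w) z B k1 x y = 0 := by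
    intro X hX
    induction X, hX using Nat.le_induction with
    | base => intro _; exact hp0
    | succ X hX ih =>
      intro hXf x hx y hy
      have ih' := ih (by omega)
      rcases Nat.lt_succ_iff_lt_or_eq.mp hx with hlt | rfl
      · exact ih' x hlt y hy
      · have hXY : 10 ^ 9 * l ^ 3 ≤ x * Y := by
          calc 10 ^ 9 * l ^ 3 = X0 * Y := by rw [hX0, hY]; ring
            _ ≤ x * Y := Nat.mul_le_mul_right _ hX
        refine step e he h n hE hns w z k1 l hz hA hzs (by omega) p T B x Y (T * B * 2 ^ Q) hpb
          (by omega) hk1 hYl ?_ (by omega) ?_ ih' y hy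
        · refine le_trans ?_ hn
          apply Nat.mul_le_mul_left
          rw [hY]
          exact Nat.mul_le_mul_right _ (by omega)
        · calc T * (B * (T * B * 2 ^ Q * 2 ^ (2 * l * T + 77 * B * x + 5 * l * B * Y)))
              = (T * B) * (T * B) * (2 ^ Q * 2 ^ (2 * l * T + 77 * B * x + 5 * l * B * Y)) := by
                ring
            _ ≤ 2 ^ l * 2 ^ l * (2 ^ Q * 2 ^ (2 * l * T + 77 * B * x + 5 * l * B * Y)) :=
                Nat.mul_le_mul_right _ (Nat.mul_le_mul hTBl hTBl)
            _ = 2 ^ (l + l + (Q + (2 * l * T + 77 * B * x + 5 * l * B * Y))) := by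
                simp only [pow_add]
            _ ≤ 2 ^ (x * Y - T) := by
                apply Nat.pow_le_pow_right (by norm_num)
                have e1 : 2 * l * T = 16 * 10 ^ 7 * l ^ 3 := by rw [hT]; ring
                have e2 : 77 * B * x = 7700 * (l * x) := by rw [hB]; ring
                have e3 : 5 * l * B * Y = 5 * 10 ^ 7 * l ^ 3 := by rw [hB, hY]; ring
                have e4 : x * Y = 10 ^ 5 * (l * x) := by rw [hY]; ring
                rw [e4] at hXY ⊢
                rw [e1, e2, e3]
                omega
  have hfin := hext (x1 + T) (by omega) le_rfl
  have hgz := growth p T B x1 ((T * B * 2 ^ Q : ℕ) : ℝ) (f (1 + 25 * w)) hf (by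
      intro a b
      have := hpb a b
      have h2 : |p a b| ≤ ((T * B * 2 ^ Q : ℕ) : ℤ) := by
        rw [Int.abs_eq_natAbs]; exact_mod_cast this
      exact_mod_cast h2) (by
      intro x hx
      have h1 := hfin x hx 0 (by rw [hY]; positivity)
      rw [vv_zero_y, QuadraticAlgebra.algebraMap_eq] at h1
      have h2 : auxF p T B (1 + 25 * w) x = 0 := congrArg QuadraticAlgebra.re h1
      have h3 := congrArg f h2
      rw [map_zero, auxF, Finset.sum_comm] at h3
      rw [← h3, map_sum]
      apply Finset.sum_congr rfl
      intro b _
      rw [map_sum, Finset.sum_mul]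
      apply Finset.sum_congr rfl
      intro a _
      simp only [map_mul, map_pow, map_intCast, map_natCast])
    (by omega) (by
      intro x hx hx2
      have hxl : x ≤ 2 ^ l := by omega
      have h1 : B * (T * (T * B * 2 ^ Q) * x ^ T) < 2 ^ x := by
        calc B * (T * (T * B * 2 ^ Q) * x ^ T) = (T * B) * (T * B) * (2 ^ Q * x ^ T) := by ring
          _ ≤ 2 ^ l * 2 ^ l * (2 ^ Q * (2 ^ l) ^ T) :=
            Nat.mul_le_mul (Nat.mul_le_mul hTBl hTBl)
              (Nat.mul_le_mul_left _ (Nat.pow_le_pow_left hxl T))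
          _ = 2 ^ (l + l + (Q + l * T)) := by simp only [pow_add, pow_mul]
          _ < 2 ^ x := by
            apply Nat.pow_lt_pow_right (by norm_num)
            have e1 : l * T = 8 * 10 ^ 7 * l ^ 3 := by rw [hT]; ring
            rw [e1]
            omega
      exact_mod_cast h1)
  obtain ⟨b, hb, a, ha, hne⟩ := hpne
  exact hne (hgz b hb a ha)

/-- The fundamental unit. -/
def alp : ℤ√2 := ⟨1, 1⟩

lemma alp_im (k : ℕ) : (alp ^ k).im = (pell k : ℤ) := by
  induction k using Nat.twoStepInduction with
  | zero => simp [pell]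
  | one => simp [pell, alp]
  | more k h1 h2 =>
    have : alp ^ (k + 2) = 2 * alp ^ (k + 1) + alp ^ k := by
      have h : alp ^ 2 = 2 * alp + 1 := by decide
      rw [pow_add, h, pow_succ]; ring
    rw [this, Zsqrtd.im_add, h1, pell]
    have h3 : (2 * alp ^ (k + 1)).im = 2 * (alp ^ (k + 1)).im := by
      simp [Zsqrtd.im_mul]
    rw [h3, h2]
    push_cast
    ring

lemma alp_norm (k : ℕ) : (alp ^ k).re * (alp ^ k).re - 2 * (pell k : ℤ) * (pell k : ℤ) =
    (-1) ^ k := by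
  have h : Zsqrtd.norm (alp ^ k) = (-1) ^ k := by
    induction k with
    | zero => simp
    | succ k ih =>
      rw [pow_succ, Zsqrtd.norm_mul, ih, pow_succ]
      congr 1
  rw [← h, Zsqrtd.norm_def, alp_im]

lemma alp_re_odd (k : ℕ) : ¬ (2 : ℤ) ∣ (alp ^ k).re := by
  rintro ⟨r, hr⟩
  have h := alp_norm k
  rw [hr] at h
  rcases neg_one_pow_eq_or ℤ k with h1 | h1 <;> rw [h1] at h
  · have : (2 : ℤ) * (2 * r * r - (pell k : ℤ) * pell k) = 1 := by linarith
    omega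
  · have : (2 : ℤ) * (2 * r * r - (pell k : ℤ) * pell k) = -1 := by linarith
    omega

lemma pell_double (j : ℕ) : (pell (2 * j) : ℤ) = 2 * pell j * (alp ^ j).re := by
  rw [← alp_im, two_mul, pow_add, Zsqrtd.im_mul, alp_im]
  ring

lemma pell_parity (k : ℕ) : pell k % 2 = k % 2 := by
  induction k using Nat.twoStepInduction with
  | zero => simp [pell]
  | one => simp [pell]
  | more k h1 h2 => rw [pell]; omega

lemma pell_two_adic (m : ℕ) : ∀ k : ℕ, 2 ^ m ∣ pell k → 2 ^ m ∣ k := by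
  induction m with
  | zero => intro k _; simp
  | succ m ih =>
    intro k hk
    have h1 : 2 ∣ pell k := (dvd_pow_self 2 (by omega)).trans hk
    have h2 := pell_parity k
    obtain ⟨j, rfl⟩ : ∃ j, k = 2 * j := ⟨k / 2, by omega⟩
    rw [pow_succ']
    apply Nat.mul_dvd_mul_left
    apply ih
    have h3 : ((2 : ℤ) ^ (m + 1)) ∣ (pell (2 * j) : ℤ) := by exact_mod_cast hk
    rw [pell_double, pow_succ', mul_assoc] at h3
    have h4 := (mul_dvd_mul_iff_left (by norm_num : (2 : ℤ) ≠ 0)).mp h3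
    have h5 : IsCoprime ((2 : ℤ) ^ m) (alp ^ j).re :=
      (((Prime.coprime_iff_not_dvd Int.prime_two)).mpr (alp_re_odd j)).pow_left
    have h6 := h5.dvd_of_dvd_mul_right h4
    exact_mod_cast h6

lemma pell_lower (k : ℕ) : 2 ^ k ≤ pell (k + 1) ∧ 2 ^ (k + 1) ≤ pell (k + 2) := by
  induction k with
  | zero => simp [pell]
  | succ k ih =>
    refine ⟨ih.2, ?_⟩
    rw [pell]
    have h2 : 2 ^ (k + 1) ≤ pell (k + 1 + 1) := ih.2
    rw [pow_succ]
    omega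

lemma E_not_sq (a m : ℕ) (ha1 : 1 ≤ a) (ha9 : a ≤ 9) (e : ℤ)
    (he : e * e = 2 * ((a * 10 ^ m : ℕ) : ℤ) ^ 2 + 81) : False := by
  have mod3 : ∀ x y : ℤ, (3 : ℤ) ∣ x * x - 2 * y ^ 2 → 3 ∣ x ∧ 3 ∣ y := by
    intro x y h
    have h1 : x % 3 = 0 ∨ x % 3 = 1 ∨ x % 3 = 2 := by omega
    have h2 : y % 3 = 0 ∨ y % 3 = 1 ∨ y % 3 = 2 := by omega
    have h3 : (x * x - 2 * y ^ 2) % 3 = 0 := Int.emod_eq_zero_of_dvd h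
    rcases h1 with h1 | h1 | h1 <;> rcases h2 with h2 | h2 | h2 <;>
      simp [pow_two, Int.sub_emod, Int.mul_emod, h1, h2] at h3 <;>
      exact ⟨Int.dvd_of_emod_eq_zero h1, Int.dvd_of_emod_eq_zero h2⟩
  obtain ⟨⟨x, rfl⟩, y, hy⟩ := mod3 e _ ⟨27, by rw [he]; ring⟩
  rw [hy] at he
  obtain ⟨⟨u, rfl⟩, v, rfl⟩ := mod3 x y ⟨3, by linarith⟩
  have huv : u * u = 2 * v ^ 2 + 1 := by linarith
  have h9 : (9 : ℕ) ∣ a * 10 ^ m := by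
    have : (9 : ℤ) ∣ ((a * 10 ^ m : ℕ) : ℤ) := ⟨v, by rw [hy]; ring⟩
    exact_mod_cast this
  have h9a : 9 ∣ a := by
    apply Nat.Coprime.dvd_of_dvd_mul_right _ h9
    exact Nat.Coprime.pow_right m (by norm_num)
  have ha : a = 9 := by omega
  subst ha
  have hv : v = 10 ^ m := by push_cast at hy; linarith
  have h10 : (v ^ 2) % 9 = 1 := by
    rw [hv, ← pow_mul, Int.emod_emod_of_dvd _ (dvd_refl _) |>.symm, Int.emod_emod_of_dvd _ (dvd_refl _)]
    have : (10 : ℤ) ^ (m * 2) ≡ 1 ^ (m * 2) [ZMOD 9] := Int.ModEq.pow _ (by decide)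
    rw [one_pow] at this
    exact this
  have h3 : (u * u) % 9 = 3 := by omega
  have h1 : u % 9 = 0 ∨ u % 9 = 1 ∨ u % 9 = 2 ∨ u % 9 = 3 ∨ u % 9 = 4 ∨ u % 9 = 5 ∨ u % 9 = 6 ∨
    u % 9 = 7 ∨ u % 9 = 8 := by omega
  rcases h1 with h1 | h1 | h1 | h1 | h1 | h1 | h1 | h1 | h1 <;>
    simp [Int.mul_emod, h1] at h3

lemma sq_of_mul_sq (r D N : ℤ) (hN : N ≠ 0) (h : r * r = D * (N * N)) : ∃ t : ℤ, t * t = D := by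
  have h1 : N ^ 2 ∣ r ^ 2 := ⟨D, by linarith⟩
  obtain ⟨t, rfl⟩ := (Int.pow_dvd_pow_iff (by norm_num)).mp h1
  refine ⟨t, ?_⟩
  have : N * N ≠ 0 := mul_ne_zero hN hN
  apply mul_right_cancel₀ this
  linarith

lemma no_sqrt (E : ℕ) (hodd : E % 2 = 1) (hE : ∀ t : ℤ, t * t ≠ (E : ℤ)) (p q : ℤ√2)
    (h : p * p = (E : ℤ√2) * (q * q)) : p = 0 ∧ q = 0 := by
  have hq : q = 0 := by
    by_contra hq
    have hN : Zsqrtd.norm q ≠ 0 := fun h0 => hq ((Zsqrtd.norm_eq_zero not_square_two q).mp h0)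
    set s := p * star q with hs
    have h1 : s * s = ((E * (q.norm * q.norm) : ℤ) : ℤ√2) := by
      have h2 := Zsqrtd.norm_eq_mul_conj q
      push_cast
      rw [h2, hs]
      linear_combination (star q * star q) * h
    have hre := congrArg Zsqrtd.re h1
    have him := congrArg Zsqrtd.im h1
    rw [Zsqrtd.re_mul, Zsqrtd.re_intCast] at hre
    rw [Zsqrtd.im_mul, Zsqrtd.im_intCast] at him
    have h3 : s.re * s.im = 0 := by linarith
    rcases mul_eq_zero.mp h3 with h4 | h4
    · rw [h4] at hre
      obtain ⟨t, ht⟩ := sq_of_mul_sq (2 * s.im) (2 * E) q.norm hN (by linarith)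
      have : ((t * t) % 4 = 0 ∨ (t * t) % 4 = 1) := by
        have h5 : t % 4 = 0 ∨ t % 4 = 1 ∨ t % 4 = 2 ∨ t % 4 = 3 := by omega
        rcases h5 with h5 | h5 | h5 | h5 <;> simp [Int.mul_emod, h5]
      omega
    · rw [h4] at hre
      obtain ⟨t, ht⟩ := sq_of_mul_sq s.re E q.norm hN (by linarith)
      exact hE t ht
  refine ⟨?_, hq⟩
  rw [hq] at h
  simpa using h

lemma pow_quintic (l : ℕ) (hl : 97 ≤ l) : 24 * 10 ^ 13 * l ^ 5 + 1 ≤ 2 ^ (l - 1) := by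
  induction l, hl using Nat.le_induction with
  | base => norm_num
  | succ l hl ih =>
    have : 2 ^ (l + 1 - 1) = 2 * 2 ^ (l - 1) := by
      rw [← pow_succ']; congr 1; omega
    rw [this]
    have h1 : (l + 1) ^ 5 ≤ 2 * l ^ 5 := by
      have e1 : 97 * l ^ 4 ≤ l ^ 5 := by rw [pow_succ' l 4]; exact Nat.mul_le_mul_right _ hl
      have e2 : 97 * l ^ 3 ≤ l ^ 4 := by rw [pow_succ' l 3]; exact Nat.mul_le_mul_right _ hl
      have e3 : 97 * l ^ 2 ≤ l ^ 3 := by rw [pow_succ' l 2]; exact Nat.mul_le_mul_right _ hl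
      have e4 : 97 * l ≤ l ^ 2 := by rw [pow_succ' l 1, pow_one]; exact Nat.mul_le_mul_right _ hl
      have : (l + 1) ^ 5 = l ^ 5 + 5 * l ^ 4 + 10 * l ^ 3 + 10 * l ^ 2 + 5 * l + 1 := by ring
      omega
    omega

lemma E_le_aux (c : ℕ) (h : 10 ≤ c) : 2 * c ^ 2 + 81 ≤ 2 * c * (2 * c) := by nlinarith

lemma core (k n m a : ℕ) (hk : 125 * 10 ^ 27 ≤ k) (h60 : 60 ∣ k) (hmn : m < n) (hm : 1 ≤ m)
    (ha1 : 1 ≤ a) (ha9 : a ≤ 9) (heq : 9 * pell k + a * 10 ^ m = a * 10 ^ n) : False := by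
  obtain ⟨k1, rfl⟩ := h60
  set k := 60 * k1 with hkk
  set c := a * 10 ^ m with hc
  set l := Nat.size k with hl
  have hk2 : k < 2 ^ l := Nat.lt_size_self k
  have hl97 : 97 ≤ l := by
    rw [hl, Nat.succ_le_iff, Nat.lt_size]
    calc 2 ^ 96 ≤ 125 * 10 ^ 27 := by norm_num
      _ ≤ k := hk
  have hk3 : 2 ^ (l - 1) ≤ k := by
    rw [← Nat.lt_size]; omega
  have hq := pow_quintic l hl97
  have hmk : 2 ^ m ∣ k := by
    apply pell_two_adic
    have h1 : 2 ^ m ∣ 9 * pell k := by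
      have h2 : (2 : ℕ) ^ m ∣ a * 10 ^ m :=
        (pow_dvd_pow_of_dvd (by norm_num : 2 ∣ 10) m).mul_left a
      have h3 : (2 : ℕ) ^ m ∣ a * 10 ^ n :=
        ((pow_dvd_pow 2 hmn.le).trans (pow_dvd_pow_of_dvd (by norm_num : 2 ∣ 10) n)).mul_left a
      exact (Nat.dvd_add_iff_left h2).mpr (heq ▸ h3)
    exact Nat.Coprime.dvd_of_dvd_mul_left (Nat.Coprime.pow_left m (by norm_num)) h1
  have hml : m < l := by
    have h1 : 2 ^ m ≤ k := Nat.le_of_dvd (by omega) hmk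
    exact (Nat.pow_lt_pow_iff_right (by norm_num : 1 < 2)).mp (h1.trans_lt hk2)
  have hc10 : 10 ≤ c := by
    calc 10 = 1 * 10 ^ 1 := by norm_num
      _ ≤ a * 10 ^ m := Nat.mul_le_mul ha1 (Nat.pow_le_pow_right (by norm_num) hm)
  have hc4 : 4 * c ≤ 2 ^ (5 * l) := by
    calc 4 * c ≤ 2 ^ 6 * (2 ^ 4) ^ m := by
          have : 10 ^ m ≤ (2 ^ 4) ^ m := Nat.pow_le_pow_left (by norm_num) m
          rw [hc]; nlinarith
      _ = 2 ^ (6 + 4 * m) := by rw [pow_add, pow_mul]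
      _ ≤ 2 ^ (5 * l) := Nat.pow_le_pow_right (by norm_num) (by omega)
  have hkn : k ≤ 4 * n + 1 := by
    have h1 := (pell_lower (k - 1)).1
    rw [Nat.sub_add_cancel (by omega)] at h1
    have h2 : pell k ≤ 10 ^ n := by
      have : a * 10 ^ n ≤ 9 * 10 ^ n := Nat.mul_le_mul_right _ ha9
      omega
    have h3 : 2 ^ (k - 1) ≤ 2 ^ (4 * n) := by
      calc 2 ^ (k - 1) ≤ 10 ^ n := h1.trans h2
        _ ≤ (2 ^ 4) ^ n := Nat.pow_le_pow_left (by norm_num) n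
        _ = 2 ^ (4 * n) := by rw [← pow_mul]
    have h4 := (Nat.pow_le_pow_iff_right (by norm_num : 1 < 2)).mp h3
    omega
  set H := (alp ^ k).re with hH
  have hHP : H * H - 2 * (pell k : ℤ) * pell k = 1 := by
    have := alp_norm k
    rwa [hkk, pow_mul (-1 : ℤ) 60, show (-1 : ℤ) ^ 60 = 1 by norm_num, one_pow] at this
  have h9P : 9 * (pell k : ℤ) + c = a * 10 ^ n := by exact_mod_cast heq
  have h510 : (5 : ℤ√2) ^ n ∣ ((10 ^ n : ℤ) : ℤ√2) := by
    push_cast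
    exact pow_dvd_pow_of_dvd ⟨2, by norm_num⟩ n
  obtain ⟨w, hw⟩ : ∃ w : ℤ√2, alp ^ 60 = 1 + 25 * w := by
    refine ⟨⟨((alp ^ 60).re - 1) / 25, (alp ^ 60).im / 25⟩, ?_⟩
    decide +kernel
  have hnw : nR (alp ^ 60) ≤ 2 ^ 77 := by decide +kernel
  refine transc (E := 2 * c ^ 2 + 81) (2 * c) (by omega) (E_le_aux c hc10) ((9 * H : ℤ) : ℤ√2) n
    ?_ ?_ w ⟨⟨0, -(c : ℤ)⟩, 1⟩ k1 l ?_ (by rw [← hw]; exact hnw) ?_ (by omega)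
    (Zsqrtd.toReal (by norm_num)) ?_ (by omega) ?_ ?_
  · have h1 : ((9 * H : ℤ) : ℤ√2) * ((9 * H : ℤ) : ℤ√2) - ((2 * c ^ 2 + 81 : ℕ) : ℤ√2) =
        ((10 ^ n : ℤ) : ℤ√2) * ((2 * (9 * (pell k : ℤ) - c) * a : ℤ) : ℤ√2) := by
      have h2 : (9 * H) * (9 * H) - (2 * (c : ℤ) ^ 2 + 81) =
          10 ^ n * (2 * (9 * (pell k : ℤ) - c) * a) := by
        linear_combination 81 * hHP + 2 * (9 * (pell k : ℤ) - c) * h9P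
      have h3 := congrArg (Int.cast : ℤ → ℤ√2) h2
      push_cast at h3 ⊢
      exact h3
    rw [h1]
    exact h510.mul_right _
  · intro p q hpq
    refine no_sqrt (2 * c ^ 2 + 81) (by omega) ?_ p q hpq
    intro t ht
    refine E_not_sq a m ha1 ha9 t ?_
    rw [ht, ← hc]; push_cast; ring
  · have h1 : phi ((9 * H : ℤ) : ℤ√2) (⟨⟨0, -(c : ℤ)⟩, 1⟩ : SS (2 * c ^ 2 + 81)) -
        9 * (1 + 25 * w) ^ k1 = ((10 ^ n : ℤ) : ℤ√2) * ⟨0, -(a : ℤ)⟩ := by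
      rw [← hw, ← pow_mul, ← hkk, phi]
      have h2 : alp ^ k = ⟨H, pell k⟩ := Zsqrtd.ext rfl (alp_im k)
      rw [h2]
      have h9 : (9 : ℤ√2) = ((9 : ℤ) : ℤ√2) := by push_cast; rfl
      rw [h9]
      apply Zsqrtd.ext
      · simp only [Zsqrtd.re_sub, Zsqrtd.re_add, Zsqrtd.re_mul, Zsqrtd.re_intCast,
          Zsqrtd.im_intCast, Zsqrtd.re_one, Zsqrtd.im_one]
        ring
      · simp only [Zsqrtd.im_sub, Zsqrtd.im_add, Zsqrtd.im_mul, Zsqrtd.re_intCast,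
          Zsqrtd.im_intCast, Zsqrtd.re_one, Zsqrtd.im_one]
        linear_combination (-1) * h9P
    rw [h1]
    exact h510.mul_right _
  · have : nS (2 * c) (⟨⟨0, -(c : ℤ)⟩, 1⟩ : SS (2 * c ^ 2 + 81)) = 4 * c := by
      simp [nS, nR]; ring
    rw [this]; exact hc4
  · rw [← hw, map_pow]
    have h1 : (2 : ℝ) ≤ Zsqrtd.toReal (by norm_num : (0 : ℤ) ≤ 2) alp := by
      have : (1 : ℝ) ≤ √2 := Real.one_le_sqrt.mpr (by norm_num)
      simp [Zsqrtd.toReal, alp, Zsqrtd.lift]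
      linarith
    calc (2 : ℝ) ≤ 2 ^ 60 := by norm_num
      _ ≤ _ := pow_le_pow_left₀ (by norm_num) h1 60
  · have h3 : l ^ 3 ≤ l ^ 5 := Nat.pow_le_pow_right (by omega) (by norm_num)
    omega
  · have : l * (6 * 10 ^ 8 * l ^ 3 * (10 ^ 5 * l)) = 6 * 10 ^ 13 * l ^ 5 := by ring
    rw [this]
    omega


lemma nine_dvd_ten_pow (n : ℕ) : (9 : ℤ) * ((10 ^ n - 1) / 9) = 10 ^ n - 1 := by
  apply Int.mul_ediv_cancel'
  have := sub_dvd_pow_sub_pow (10 : ℤ) 1 n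
  simpa using this

/-- Under the hypotheses of the Pell equation, `k < 1.25 * 10^29`. -/
theorem pell_k_bound (k n m a1 a2 : ℕ) (hk : 150 ≤ k) (hnm : m < n) (hm : 1 ≤ m)
    (ha11 : 1 ≤ a1) (ha19 : a1 ≤ 9) (ha21 : 1 ≤ a2) (ha29 : a2 ≤ 9)
    (heq : (pell k : ℤ) = (a1 : ℤ) * ((10 ^ n - 1) / 9) - (a2 : ℤ) * ((10 ^ m - 1) / 9)) :
    (k : ℝ) < 1.25 * 10 ^ 29 := by
  by_contra hcon
  push Not at hcon
  have hkk : 125 * 10 ^ 27 ≤ k := by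
    have : ((125 * 10 ^ 27 : ℕ) : ℝ) ≤ (k : ℝ) := by
      refine le_trans (le_of_eq ?_) hcon
      norm_num
    exact_mod_cast this
  have h1 : 9 * (pell k : ℤ) + a1 + a2 * 10 ^ m = a1 * 10 ^ n + a2 := by
    have hn9 := nine_dvd_ten_pow n
    have hm9 := nine_dvd_ten_pow m
    rw [heq]
    linear_combination (a1 : ℤ) * hn9 - (a2 : ℤ) * hm9
  have h2 : 9 * pell k + a1 + a2 * 10 ^ m = a1 * 10 ^ n + a2 := by exact_mod_cast h1
  have hn5 : 5 ≤ n := by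
    by_contra hlt
    push Not at hlt
    have h3 := (pell_lower (k - 1)).1
    rw [Nat.sub_add_cancel (by omega)] at h3
    have h4 : 2 ^ 149 ≤ 2 ^ (k - 1) := Nat.pow_le_pow_right (by norm_num) (by omega)
    have h5 : a1 * 10 ^ n ≤ 9 * 10 ^ 4 :=
      Nat.mul_le_mul ha19 (Nat.pow_le_pow_right (by norm_num) (by omega))
    have h6 : 2 ^ 149 ≤ pell k := h4.trans h3
    have h7 : 10 ^ 6 ≤ 2 ^ 149 := by norm_num
    have h8 : 10 ^ 6 ≤ pell k := h7.trans h6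
    clear h3 h4 h6 h7 hkk hcon
    omega
  obtain ⟨ha, h60⟩ := sieve k n m a1 a2 hn5 hm ha11 ha19 ha21 ha29 h2
  subst ha
  exact core k n m a1 hkk h60 hnm hm ha11 ha19 (by omega)
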